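/- Assume in addition that α > 3, the step-size is constant s_k ≡ s ∈ (0, 1/L], β_k ≡ β = η √s/2 for some η ∈ (0,1], and Assumption (J0) holds. Then the sequence (x_k) converges weakly to a minimizer of f: there exists x̄ ∈ S such that ⟨x_k, h⟩ → ⟨x̄, h⟩ as k → ∞ for every h ∈ H. -/

import Mathlib

set_option autoImplicit false

open Filter
open scoped RealInnerProductSpace

section Gradient

variable {H : Type*} [NormedAddCommGroup H] [InnerProductSpace ℝ H] [CompleteSpace H]
  {f : H → ℝ} {f' : H → H}

lemma HasGradientAt.hasDerivAt_comp_line {g z d : H} {t : ℝ}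
    (h : HasGradientAt f g (z + t • d)) :
    HasDerivAt (fun τ : ℝ => f (z + τ • d)) ⟪g, d⟫ t := by
  have h1 : HasDerivAt (fun τ : ℝ => z + τ • d) d t := by
    simpa using ((hasDerivAt_id t).smul_const d).const_add z
  have h2 := h.hasFDerivAt.comp_hasDerivAt t h1
  rwa [InnerProductSpace.toDual_apply_apply] at h2

lemma ConvexOn.add_inner_gradient_le (hconv : ConvexOn ℝ Set.univ f) {g z : H}
    (h : HasGradientAt f g z) (w : H) : f z + ⟪g, w - z⟫ ≤ f w := by
  have hc : ConvexOn ℝ Set.univ (fun t : ℝ => f (z + t • (w - z))) := by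
    have := hconv.comp_affineMap (AffineMap.lineMap z w : ℝ →ᵃ[ℝ] H)
    simpa [Function.comp_def, AffineMap.lineMap_apply, add_comm] using this
  have hd : HasDerivAt (fun t : ℝ => f (z + t • (w - z))) ⟪g, w - z⟫ 0 :=
    HasGradientAt.hasDerivAt_comp_line (by simpa using h)
  have := hc.le_slope_of_hasDerivAt (Set.mem_univ 0) (Set.mem_univ 1) one_pos hd
  simp [slope_def_field] at this
  linarith

lemma le_add_inner_gradient_add_sq {L : ℝ} (hdiff : ∀ z, HasGradientAt f (f' z) z)
    (hlip : ∀ z w, ‖f' z - f' w‖ ≤ L * ‖z - w‖) (z w : H) :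
    f w ≤ f z + ⟪f' z, w - z⟫ + L / 2 * ‖w - z‖ ^ 2 := by
  set d := w - z with hd
  let ψ : ℝ → ℝ := fun t => f (z + t • d) - (t * ⟪f' z, d⟫ + t ^ 2 * (L / 2 * ‖d‖ ^ 2))
  have hψ : ∀ t, HasDerivAt ψ
      (⟪f' (z + t • d), d⟫ - (⟪f' z, d⟫ + 2 * t * (L / 2 * ‖d‖ ^ 2))) t := by
    intro t
    have h2 := ((hasDerivAt_id t).mul_const ⟪f' z, d⟫).add
      ((hasDerivAt_pow 2 t).mul_const (L / 2 * ‖d‖ ^ 2))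
    refine ((hdiff (z + t • d)).hasDerivAt_comp_line.sub h2).congr_deriv ?_
    simp
  have hanti : AntitoneOn ψ (Set.Icc 0 1) := by
    refine antitoneOn_of_deriv_nonpos (convex_Icc 0 1)
      (fun t _ => (hψ t).continuousAt.continuousWithinAt)
      (fun t _ => (hψ t).differentiableAt.differentiableWithinAt) ?_
    intro t ht
    rw [interior_Icc] at ht
    rw [(hψ t).deriv]
    have h1 : ⟪f' (z + t • d) - f' z, d⟫ ≤ L * (t * ‖d‖) * ‖d‖ := by
      refine (real_inner_le_norm _ _).trans ?_
      have := hlip (z + t • d) z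
      rw [add_sub_cancel_left, norm_smul, Real.norm_of_nonneg ht.1.le] at this
      gcongr
    rw [inner_sub_left] at h1
    nlinarith
  have := hanti (Set.left_mem_Icc.2 zero_le_one) (Set.right_mem_Icc.2 zero_le_one) zero_le_one
  simp only [ψ] at this
  rw [one_smul, zero_smul, hd, add_sub_cancel, add_zero, ← hd] at this
  linarith

/-- Cocoercive refinement of the gradient inequality. -/
lemma ConvexOn.le_add_inner_gradient_sub_sq {L s : ℝ} (hconv : ConvexOn ℝ Set.univ f)
    (hdiff : ∀ z, HasGradientAt f (f' z) z)
    (hlip : ∀ z w, ‖f' z - f' w‖ ≤ L * ‖z - w‖) (hs : 0 < s) (hsL : L * s ≤ 1) (x y : H) :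
    f y ≤ f x + ⟪f' y, y - x⟫ - s / 2 * ‖f' x - f' y‖ ^ 2 := by
  have h1 := hconv.add_inner_gradient_le (hdiff y) (x - s • (f' x - f' y))
  have h2 := le_add_inner_gradient_add_sq hdiff hlip x (x - s • (f' x - f' y))
  rw [sub_sub_cancel_left, norm_neg, norm_smul, Real.norm_of_nonneg hs.le, inner_neg_right,
    inner_smul_right] at h2
  have e1 : ⟪f' y, x - s • (f' x - f' y) - y⟫
      = -⟪f' y, y - x⟫ - s * ⟪f' y, f' x - f' y⟫ := by
    simp only [inner_sub_right, inner_smul_right]; ring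
  have e2 : ‖f' x - f' y‖ ^ 2 = ⟪f' x, f' x - f' y⟫ - ⟪f' y, f' x - f' y⟫ := by
    rw [← inner_sub_left, real_inner_self_eq_norm_sq]
  rw [e1] at h1
  have h3 : L * s * (s * ‖f' x - f' y‖ ^ 2) ≤ 1 * (s * ‖f' x - f' y‖ ^ 2) := by gcongr
  nlinarith

lemma le_sub_sq_of_inexact_gradient_step {L s : ℝ} (hdiff : ∀ z, HasGradientAt f (f' z) z)
    (hlip : ∀ z w, ‖f' z - f' w‖ ≤ L * ‖z - w‖) (hs : 0 < s) (hsL : L * s ≤ 1) (y e : H) :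
    f (y - s • (f' y + e)) ≤ f y - s / 2 * ‖f' y‖ ^ 2 + s / 2 * ‖e‖ ^ 2 := by
  have h := le_add_inner_gradient_add_sq hdiff hlip y (y - s • (f' y + e))
  rw [sub_sub_cancel_left, norm_neg, norm_smul, Real.norm_of_nonneg hs.le, inner_neg_right,
    inner_smul_right, inner_add_right, real_inner_self_eq_norm_sq] at h
  have e1 := norm_add_sq_real (f' y) e
  have h3 : L * s * (s * ‖f' y + e‖ ^ 2) ≤ 1 * (s * ‖f' y + e‖ ^ 2) := by gcongr
  nlinarith

/-- One step of the Lyapunov analysis; `c` is the weight put on the distance to `p`. -/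
lemma inexact_step_energy_le {L s b k c : ℝ} (hconv : ConvexOn ℝ Set.univ f)
    (hdiff : ∀ z, HasGradientAt f (f' z) z)
    (hlip : ∀ z w, ‖f' z - f' w‖ ≤ L * ‖z - w‖) (hs : 0 < s) (hsL : L * s ≤ 1)
    (hb : 0 ≤ b) (hbs : 2 * b ≤ s) (hk : 0 ≤ k) (hc : 0 ≤ c) (hck : 2 * c ≤ k)
    {x y p M N v w : H}
    (hw : w = c • (x - p) + k • (y - x) + (b * k) • (f' x + M))
    (hv : v = w - (s * k) • (f' y + N)) :
    s * k ^ 2 * (f (y - s • (f' y + N)) - f p) + ‖v‖ ^ 2 / 2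
        + s * b * k ^ 2 / 2 * ‖f' x‖ ^ 2
      ≤ s * (k * (k - c)) * (f x - f p) + ‖w‖ ^ 2 / 2 + s * k * ‖N‖ * ‖v‖
        + s * b * k ^ 2 * ‖M‖ ^ 2 := by
  have hstep := le_sub_sq_of_inexact_gradient_step hdiff hlip hs hsL y N
  have hx := hconv.le_add_inner_gradient_sub_sq hdiff hlip hs hsL x y
  have hp := hconv.add_inner_gradient_le (hdiff y) p
  have hnorm : ‖v‖ ^ 2 / 2 = ‖w‖ ^ 2 / 2 - s * k * ⟪f' y, w⟫ + (s * k) ^ 2 / 2 * ‖f' y‖ ^ 2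
      - s * k * ⟪N, v⟫ - (s * k) ^ 2 / 2 * ‖N‖ ^ 2 := by
    rw [hv]
    simp only [← real_inner_self_eq_norm_sq, inner_sub_left, inner_sub_right, inner_add_left,
      inner_add_right, inner_smul_left, inner_smul_right, real_inner_comm, RCLike.conj_to_real]
    ring
  have hGw : ⟪f' y, w⟫ = c * -⟪f' y, p - y⟫ + (k - c) * ⟪f' y, y - x⟫
      + b * k * ⟪f' y, f' x⟫ + b * k * ⟪f' y, M⟫ := by
    rw [hw]
    simp only [inner_sub_right, inner_add_right, inner_smul_right]
    ring
  have hg := norm_sub_sq_real (f' x) (f' y)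
  rw [real_inner_comm] at hg
  have hGM : -⟪f' y, M⟫ ≤ ‖f' y‖ ^ 2 / 4 + ‖M‖ ^ 2 := by
    have := (abs_le.1 (abs_real_inner_le_norm (f' y) M)).1
    nlinarith [sq_nonneg (‖f' y‖ / 2 - ‖M‖)]
  have hNv : -⟪N, v⟫ ≤ ‖N‖ * ‖v‖ := by
    have := (abs_le.1 (abs_real_inner_le_norm N v)).1
    linarith
  have m1 := mul_le_mul_of_nonneg_left hstep (by positivity : 0 ≤ s * k ^ 2)
  have m2 := mul_le_mul_of_nonneg_left hx
    (mul_nonneg (mul_nonneg hs.le hk) (by linarith : 0 ≤ k - c))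
  have m3 := mul_le_mul_of_nonneg_left hp (by positivity : 0 ≤ s * k * c)
  have m4 := mul_le_mul_of_nonneg_left hGM (by positivity : 0 ≤ s * k * (b * k))
  have m5 := mul_le_mul_of_nonneg_left hNv (by positivity : 0 ≤ s * k)
  have hcoef : b * k ≤ s * (k - c) := by nlinarith
  have m6 := mul_le_mul_of_nonneg_right hcoef
    (by positivity : 0 ≤ s * k / 2 * ‖f' x - f' y‖ ^ 2)
  have m7 : 0 ≤ s * b * k ^ 2 * ‖f' y‖ ^ 2 := by positivity
  rw [hnorm, hGw]
  have m8 : s * k * (b * k) / 2 * ‖f' x - f' y‖ ^ 2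
      = s * k * (b * k) / 2 * (‖f' x‖ ^ 2 - 2 * ⟪f' y, f' x⟫ + ‖f' y‖ ^ 2) := by rw [hg]
  linarith

end Gradient

section Opial

variable {H : Type*} [NormedAddCommGroup H] [InnerProductSpace ℝ H] [CompleteSpace H]

/-- A bounded family in a Hilbert space converges weakly along every ultrafilter. -/
lemma Ultrafilter.exists_weak_limit_of_norm_le {ι : Type*} (U : Ultrafilter ι) {x : ι → H} {R : ℝ}
    (hx : ∀ i, ‖x i‖ ≤ R) :
    ∃ p : H, ∀ h : H, Tendsto (fun i => ⟪x i, h⟫) U (nhds ⟪p, h⟫) := by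
  let φ : ι → WeakDual ℝ H := fun i => StrongDual.toWeakDual (InnerProductSpace.toDual ℝ H (x i))
  have hK := WeakDual.isCompact_closedBall (𝕜 := ℝ) (0 : StrongDual ℝ H) R
  obtain ⟨ψ, -, hψ⟩ := hK.ultrafilter_le_nhds (U.map φ) (by
    rw [Filter.le_principal_iff, Ultrafilter.mem_coe, Ultrafilter.mem_map]
    exact Filter.Eventually.of_forall fun i => by simpa [φ] using hx i)
  refine ⟨(InnerProductSpace.toDual ℝ H).symm (WeakDual.toStrongDual ψ), fun h => ?_⟩
  have h1 : Tendsto (fun i => φ i h) U (nhds (ψ h)) :=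
    ((WeakDual.eval_continuous h).tendsto ψ).comp hψ
  simpa [φ] using h1

/-- **Opial's lemma**. -/
lemma exists_weak_limit_of_tendsto_norm_sub {S : Set H} (hS : S.Nonempty) {x : ℕ → H}
    (hdist : ∀ p ∈ S, ∃ l, Tendsto (fun k => ‖x k - p‖) atTop (nhds l))
    (hclus : ∀ (U : Ultrafilter ℕ) (p : H), (U : Filter ℕ) ≤ atTop →
      (∀ h : H, Tendsto (fun k => ⟪x k, h⟫) U (nhds ⟪p, h⟫)) → p ∈ S) :
    ∃ p ∈ S, ∀ h : H, Tendsto (fun k => ⟪x k, h⟫) atTop (nhds ⟪p, h⟫) := by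
  obtain ⟨q, hq⟩ := hS
  obtain ⟨l, hl⟩ := hdist q hq
  obtain ⟨R, hR⟩ := hl.bddAbove_range
  have hbd : ∀ k, ‖x k‖ ≤ R + ‖q‖ := fun k => by
    have h1 : ‖x k - q‖ ≤ R := hR ⟨k, rfl⟩
    have h2 := norm_add_le (x k - q) q
    rw [sub_add_cancel] at h2
    linarith
  obtain ⟨p, hp⟩ := (Ultrafilter.of (atTop : Filter ℕ)).exists_weak_limit_of_norm_le hbd
  have hpS := hclus _ p (Ultrafilter.of_le _) hp
  refine ⟨p, hpS, fun h => ?_⟩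
  rw [tendsto_iff_ultrafilter]
  intro U hU
  obtain ⟨r, hr⟩ := U.exists_weak_limit_of_norm_le hbd
  have hrS := hclus U r hU hr
  suffices r = p by
    subst this; exact hr h
  obtain ⟨l₁, h₁⟩ := hdist p hpS
  obtain ⟨l₂, h₂⟩ := hdist r hrS
  have h3 : Tendsto (fun k => ⟪x k, r - p⟫) atTop
      (nhds ((l₁ ^ 2 - l₂ ^ 2 - ‖p‖ ^ 2 + ‖r‖ ^ 2) / 2)) := by
    refine (((((h₁.pow 2).sub (h₂.pow 2)).sub_const (‖p‖ ^ 2)).add_const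
      (‖r‖ ^ 2)).div_const 2).congr fun k => ?_
    rw [norm_sub_sq_real, norm_sub_sq_real, inner_sub_right]
    ring
  have e1 := tendsto_nhds_unique (hp (r - p)) (h3.mono_left (Ultrafilter.of_le _))
  have e2 := tendsto_nhds_unique (hr (r - p)) (h3.mono_left hU)
  rw [← sub_eq_zero, ← inner_self_eq_zero (𝕜 := ℝ), inner_sub_left, e1, e2, sub_self]

end Opial

section RealSequences

/-- A nonnegative sequence that decreases up to summable errors converges, and the decrease is
summable. -/
lemma tendsto_and_summable_of_le_add {E D c : ℕ → ℝ} (hE : ∀ k, 0 ≤ E k) (hD : ∀ k, 0 ≤ D k)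
    (hc : Summable c) {K : ℕ} (h : ∀ k ≥ K, E (k + 1) + D k ≤ E k + c k) :
    (∃ l, Tendsto E atTop (nhds l)) ∧ Summable D := by
  have hc' : Summable fun k => c (k + K) := (summable_nat_add_iff K).2 hc
  have h' : ∀ k, E (k + K + 1) + D (k + K) ≤ E (k + K) + c (k + K) := fun k => h _ (by omega)
  obtain ⟨B, hB⟩ := hc'.hasSum.tendsto_sum_nat.bddAbove_range
  have hB' : ∀ n, ∑ i ∈ Finset.range n, c (i + K) ≤ B := fun n => hB ⟨n, rfl⟩
  have hsum : ∀ n, E (n + K) + ∑ i ∈ Finset.range n, D (i + K)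
      ≤ E K + ∑ i ∈ Finset.range n, c (i + K) := by
    intro n
    induction n with
    | zero => simp
    | succ n ih =>
      rw [Finset.sum_range_succ, Finset.sum_range_succ]
      have := h' n
      rw [show n + 1 + K = n + K + 1 by ring]
      linarith
  constructor
  · let u : ℕ → ℝ := fun n => E (n + K) - ∑ i ∈ Finset.range n, c (i + K)
    have hu : Antitone u := antitone_nat_of_succ_le fun n => by
      simp only [u, Finset.sum_range_succ]
      have := h' n
      rw [show n + 1 + K = n + K + 1 by ring]
      linarith [hD (n + K)]
    have hub : BddBelow (Set.range u) := ⟨-B, by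
      rintro _ ⟨n, rfl⟩
      simp only [u]
      linarith [hE (n + K), hB' n]⟩
    refine ⟨_, (tendsto_add_atTop_iff_nat K).1
      (((tendsto_atTop_ciInf hu hub).add hc'.hasSum.tendsto_sum_nat).congr fun n => ?_)⟩
    simp [u]
  · refine (summable_nat_add_iff K).1
      (summable_of_sum_range_le (c := E K + B) (fun n => hD _) fun n => ?_)
    linarith [hsum n, hB' n, hE (n + K)]

/-- A discrete Gronwall bound with an implicit error term. -/
lemma exists_forall_le_of_le_add_mul {E r a c : ℕ → ℝ} (hE : ∀ k, 0 ≤ E k)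
    (hr : ∀ k, r k ≤ 1 / 2 + E k) (ha0 : ∀ k, 0 ≤ a k) (hc0 : ∀ k, 0 ≤ c k)
    (ha : Summable a) (hc : Summable c) {K : ℕ}
    (h : ∀ k ≥ K, E (k + 1) ≤ E k + a k * r (k + 1) + c k) :
    ∃ B, ∀ k, E k ≤ B := by
  obtain ⟨K', hK'⟩ := eventually_atTop.1
    (ha.tendsto_atTop_zero.eventually (gt_mem_nhds (by norm_num : (0 : ℝ) < 1 / 2)))
  set m := max K K' with hm
  let q : ℕ → ℝ := fun k => c (k + m) + 2 * a (k + m)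
  have hq0 : ∀ k, 0 ≤ q k := fun k => by
    have := ha0 (k + m); have := hc0 (k + m); simp only [q]; positivity
  have hq : Summable q :=
    ((summable_nat_add_iff m).2 hc).add (((summable_nat_add_iff m).2 ha).mul_left 2)
  have hstep : ∀ n, 1 + E (n + m + 1) ≤ Real.exp (q n) * (1 + E (n + m)) := by
    intro n
    have h1 := h (n + m) (by omega)
    have h2 := hK' (n + m) (by omega)
    have h3 := mul_le_mul_of_nonneg_left (hr (n + m + 1)) (ha0 (n + m))
    have hE0 := hE (n + m)
    have hE1 := hE (n + m + 1)
    have ha1 := ha0 (n + m)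
    have hc1 := hc0 (n + m)
    have h4 : (1 - a (n + m)) * (1 + E (n + m + 1)) ≤ (1 + c (n + m)) * (1 + E (n + m)) := by
      nlinarith
    have h5 : 1 + E (n + m + 1)
        ≤ (1 + 2 * a (n + m)) * ((1 - a (n + m)) * (1 + E (n + m + 1))) := by
      nlinarith [mul_nonneg ha1 (by linarith : 0 ≤ 1 - 2 * a (n + m))]
    calc 1 + E (n + m + 1)
        ≤ (1 + 2 * a (n + m)) * ((1 + c (n + m)) * (1 + E (n + m))) :=
          h5.trans (by gcongr)
      _ ≤ Real.exp (2 * a (n + m)) * (Real.exp (c (n + m)) * (1 + E (n + m))) := by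
          have e1 := Real.add_one_le_exp (2 * a (n + m))
          have e2 := Real.add_one_le_exp (c (n + m))
          gcongr <;> linarith
      _ = Real.exp (q n) * (1 + E (n + m)) := by
          simp only [q, Real.exp_add]; ring
  have hall : ∀ n, 1 + E (n + m) ≤ Real.exp (∑ i ∈ Finset.range n, q i) * (1 + E m) := by
    intro n
    induction n with
    | zero => simp
    | succ n ih =>
      rw [Finset.sum_range_succ, Real.exp_add, show n + 1 + m = n + m + 1 by ring]
      refine (hstep n).trans ?_
      have := mul_le_mul_of_nonneg_left ih (Real.exp_pos (q n)).le
      linarith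
  have hev : ∀ k ≥ m, E k ≤ Real.exp (∑' i, q i) * (1 + E m) := by
    intro k hk
    obtain ⟨n, rfl⟩ := Nat.exists_eq_add_of_le' hk
    have h1 : ∑ i ∈ Finset.range n, q i ≤ ∑' i, q i := hq.sum_le_tsum _ fun i _ => hq0 i
    have h2 : Real.exp (∑ i ∈ Finset.range n, q i) * (1 + E m)
        ≤ Real.exp (∑' i, q i) * (1 + E m) := by
      have := hE m
      gcongr
    linarith [hall n]
  obtain ⟨B, hB⟩ := (isBoundedUnder_of_eventually_le
    (eventually_atTop.2 ⟨m, hev⟩) : IsBoundedUnder (· ≤ ·) atTop E).bddAbove_range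
  exact ⟨B, fun k => hB ⟨k, rfl⟩⟩

lemma exists_forall_le_of_le_contraction {a : ℕ → ℝ} {c R : ℝ} (hc : 0 < c) {K : ℕ} (hcK : c ≤ K)
    (h : ∀ k ≥ K, a (k + 1) ≤ (1 - c / k) * a k + R / k) : ∃ B, ∀ k, a k ≤ B := by
  have hev : ∀ k ≥ K, a k ≤ max (a K) (R / c) := by
    intro k hk
    induction k, hk using Nat.le_induction with
    | base => exact le_max_left _ _
    | succ k hk ih =>
      have hk' : (K : ℝ) ≤ k := by exact_mod_cast hk
      have hk0 : (0 : ℝ) < k := by linarith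
      have h1 : 0 ≤ 1 - c / k := by
        rw [sub_nonneg, div_le_one hk0]; linarith
      have h2 : R / k = c / k * (R / c) := by field_simp
      have h3 : 0 ≤ c / k := by positivity
      have h4 := mul_le_mul_of_nonneg_left ih h1
      have h5 := mul_le_mul_of_nonneg_left (le_max_right (a K) (R / c)) h3
      linarith [h k hk]
  obtain ⟨B, hB⟩ := (isBoundedUnder_of_eventually_le
    (eventually_atTop.2 ⟨K, hev⟩) : IsBoundedUnder (· ≤ ·) atTop a).bddAbove_range
  exact ⟨B, fun k => hB ⟨k, rfl⟩⟩

/-- Discrete analogue of: `c h + t h'` converges implies that `h` converges. -/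
lemma tendsto_of_tendsto_mul_add_natCast_mul_sub {h : ℕ → ℝ} {c l : ℝ} (hc : 0 < c)
    (hl : Tendsto (fun k : ℕ => c * h k + k * (h (k + 1) - h k)) atTop (nhds l)) :
    Tendsto h atTop (nhds (l / c)) := by
  rw [Metric.tendsto_atTop]
  intro ε hε
  let z : ℕ → ℝ := fun k => max (|h k - l / c| - ε / 2) 0
  have hz0 : ∀ k, 0 ≤ z k := fun k => le_max_right _ _
  obtain ⟨K₁, hK₁⟩ := Metric.tendsto_atTop.1 hl (c * (ε / 2)) (by positivity)
  obtain ⟨K₂, hK₂⟩ := exists_nat_ge c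
  set K := max K₁ (max K₂ 1) with hK
  have hcK : ∀ k ≥ K, c ≤ (k : ℝ) := fun k hk =>
    hK₂.trans (by exact_mod_cast (by omega : K₂ ≤ k))
  have hstep : ∀ k ≥ K, z (k + 1) + c * (z k / k) ≤ z k + 0 := by
    intro k hk
    have hk0 : (0 : ℝ) < k := hc.trans_le (hcK k hk)
    have h1 := hK₁ k (by omega)
    rw [Real.dist_eq] at h1
    have hq : 0 ≤ 1 - c / k := by
      rw [sub_nonneg, div_le_one hk0]; exact hcK k hk
    have e1 : h (k + 1) - l / c = (1 - c / k) * (h k - l / c)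
        + (c * h k + k * (h (k + 1) - h k) - l) / k := by
      field_simp; ring
    have h2 : |h (k + 1) - l / c| ≤ (1 - c / k) * |h k - l / c| + c * (ε / 2) / k := by
      rw [e1]
      refine (abs_add_le _ _).trans ?_
      rw [abs_mul, abs_of_nonneg hq, abs_div, abs_of_pos hk0]
      gcongr
    have h3 : |h k - l / c| - ε / 2 ≤ z k := le_max_left _ _
    have h4 := mul_le_mul_of_nonneg_left h3 hq
    have h5 : z (k + 1) ≤ (1 - c / k) * z k := by
      refine max_le ?_ (mul_nonneg hq (hz0 k))
      have : c * (ε / 2) / k = c / k * (ε / 2) := by ring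
      linarith
    have : c * (z k / k) = c / k * z k := by ring
    linarith
  obtain ⟨⟨m, hm⟩, hsum⟩ := tendsto_and_summable_of_le_add (D := fun k => c * (z k / k)) hz0
    (fun k => by have := hz0 k; positivity) summable_zero hstep
  have hm0 : m ≤ 0 := by
    by_contra! hpos
    have hsum' : Summable fun k : ℕ => z k / k := (summable_mul_left_iff hc.ne').1 hsum
    obtain ⟨K', hK'⟩ := eventually_atTop.1 (hm.eventually (lt_mem_nhds (half_lt_self hpos)))
    refine Real.not_summable_one_div_natCast ((summable_nat_add_iff K').1 ?_)
    refine Summable.of_nonneg_of_le (fun k => by positivity) (fun k => ?_)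
      (((summable_nat_add_iff K').2 hsum').mul_left (2 / m))
    have h1 := hK' (k + K') (by omega)
    rw [mul_div_assoc']
    gcongr
    rw [div_mul_eq_mul_div, le_div_iff₀ hpos]
    linarith
  obtain ⟨N, hN⟩ := eventually_atTop.1
    (hm.eventually (gt_mem_nhds (hm0.trans_lt (half_pos hε))))
  refine ⟨N, fun k hk => ?_⟩
  have h1 := hN k hk
  have h2 : |h k - l / c| - ε / 2 ≤ z k := le_max_left _ _
  rw [Real.dist_eq]
  linarith

end RealSequences

section InexactIGAHD

variable {H : Type*} [NormedAddCommGroup H] [InnerProductSpace ℝ H]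

/-- The inexact IGAHD recursion with constant step-size `s` and constant damping, where `b` stands
for `β √s`. The inertial relation is multiplied by the iteration index. -/
structure IsInexactIGAHD (f' : H → H) (α s b : ℝ) (x y M N : ℕ → H) : Prop where
  inertial : ∀ k : ℕ, 1 ≤ k → ((k : ℝ) + 1) • (y (k + 1) - x (k + 1)) =
    ((k : ℝ) + 1 - α) • (x (k + 1) - x k) - (b * ((k : ℝ) + 1)) • (f' (x (k + 1)) + M (k + 1))
      + (b * (k : ℝ)) • (f' (x k) + M k)
  step : ∀ k : ℕ, 1 ≤ k → x (k + 1) = y k - s • (f' (y k) + N k)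

/-- The vector `b k (∇f(x_k) + M_k)`. -/
noncomputable def igahdDamping (f' : H → H) (b : ℝ) (x M : ℕ → H) (k : ℕ) : H :=
  (b * (k : ℝ)) • (f' (x k) + M k)

/-- The anchored velocity `c (x_k - p) + k (x_{k+1} - x_k) + b k (∇f(x_k) + M_k)`. -/
noncomputable def igahdVelocity (f' : H → H) (b : ℝ) (x M : ℕ → H) (p : H) (c : ℝ) (k : ℕ) : H :=
  c • (x k - p) + (k : ℝ) • (x (k + 1) - x k) + igahdDamping f' b x M k

/-- The Lyapunov energy with anchoring weight `c`. -/
noncomputable def igahdEnergy (f : H → ℝ) (f' : H → H) (s b : ℝ) (x M : ℕ → H) (p : H)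
    (c : ℝ) (k : ℕ) : ℝ :=
  s * (k : ℝ) ^ 2 * (f (x (k + 1)) - f p) + ‖igahdVelocity f' b x M p c k‖ ^ 2 / 2

lemma Summable.sq_of_nonneg {u : ℕ → ℝ} (h0 : ∀ k, 0 ≤ u k) (hu : Summable u) :
    Summable fun k => u k ^ 2 := by
  obtain ⟨B, hB⟩ := hu.tendsto_atTop_zero.bddAbove_range
  refine Summable.of_nonneg_of_le (fun k => sq_nonneg _) (fun k => ?_) (hu.mul_left B)
  rw [sq]
  exact mul_le_mul_of_nonneg_right (hB ⟨k, rfl⟩) (h0 k)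

variable {f : H → ℝ} {f' : H → H} {L α s b : ℝ} {x y M N : ℕ → H} {p : H}

lemma igahdEnergy_nonneg (hs : 0 < s) (hp : ∀ z, f p ≤ f z) (c : ℝ) (k : ℕ) :
    0 ≤ igahdEnergy f f' s b x M p c k := by
  have := sub_nonneg.2 (hp (x (k + 1)))
  unfold igahdEnergy
  positivity

lemma norm_igahdVelocity_le (hs : 0 < s) (hp : ∀ z, f p ≤ f z) (c : ℝ) (k : ℕ) :
    ‖igahdVelocity f' b x M p c k‖ ≤ 1 / 2 + igahdEnergy f f' s b x M p c k := by
  have h1 := sub_nonneg.2 (hp (x (k + 1)))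
  have h2 : 0 ≤ s * (k : ℝ) ^ 2 * (f (x (k + 1)) - f p) := by positivity
  unfold igahdEnergy
  nlinarith [sq_nonneg (‖igahdVelocity f' b x M p c k‖ - 1)]

lemma summable_norm_igahdDamping_sq
    (hg : Summable fun k : ℕ => (k : ℝ) ^ 2 * ‖f' (x k)‖ ^ 2)
    (hM : Summable fun k : ℕ => (k : ℝ) * ‖M k‖) :
    Summable fun k => ‖igahdDamping f' b x M k‖ ^ 2 := by
  refine Summable.of_nonneg_of_le (fun k => by positivity) (fun k => ?_)
    ((hg.add (hM.sq_of_nonneg fun k => by positivity)).mul_left (2 * b ^ 2))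
  rw [igahdDamping, norm_smul, mul_pow, Real.norm_eq_abs, sq_abs]
  have h1 : ‖f' (x k) + M k‖ ^ 2 ≤ 2 * (‖f' (x k)‖ ^ 2 + ‖M k‖ ^ 2) := by
    have := pow_le_pow_left₀ (norm_nonneg _) (norm_add_le (f' (x k)) (M k)) 2
    nlinarith [sq_nonneg (‖f' (x k)‖ - ‖M k‖)]
  have h2 := mul_le_mul_of_nonneg_left h1 (sq_nonneg (b * (k : ℝ)))
  nlinarith

/-- If the anchored velocity and the damping are bounded, so are the positions and velocities. -/
lemma exists_norm_le_of_norm_igahdVelocity_le {c B B' : ℝ} (hc : 0 < c)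
    (hV : ∀ k, ‖igahdVelocity f' b x M p c k‖ ≤ B) (hq : ∀ k, ‖igahdDamping f' b x M k‖ ≤ B') :
    ∃ R, (∀ k, ‖x k - p‖ ≤ R) ∧ ∀ k : ℕ, (k : ℝ) * ‖x (k + 1) - x k‖ ≤ R := by
  have hu : ∀ k : ℕ, ‖c • (x k - p) + (k : ℝ) • (x (k + 1) - x k)‖ ≤ B + B' := fun k => by
    have e : c • (x k - p) + (k : ℝ) • (x (k + 1) - x k)
        = igahdVelocity f' b x M p c k - igahdDamping f' b x M k := by
      rw [igahdVelocity]; abel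
    rw [e]
    exact (norm_sub_le _ _).trans (add_le_add (hV k) (hq k))
  obtain ⟨K, hK⟩ := exists_nat_ge c
  obtain ⟨P, hP⟩ := exists_forall_le_of_le_contraction (a := fun k => ‖x k - p‖) (R := B + B')
    hc hK fun k hk => by
      have hk' : c ≤ (k : ℝ) := hK.trans (by exact_mod_cast hk)
      have hk0 : (0 : ℝ) < k := hc.trans_le hk'
      have hq : 0 ≤ 1 - c / k := by rw [sub_nonneg, div_le_one hk0]; exact hk'
      have e : x (k + 1) - p = (1 - c / k) • (x k - p)
          + (1 / (k : ℝ)) • (c • (x k - p) + (k : ℝ) • (x (k + 1) - x k)) := by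
        have : (1 / (k : ℝ)) * k = 1 := by field_simp
        rw [smul_add, smul_smul, smul_smul, this, div_eq_mul_one_div c]
        module
      rw [e]
      refine (norm_add_le _ _).trans ?_
      rw [norm_smul, norm_smul, Real.norm_of_nonneg hq, Real.norm_of_nonneg (by positivity),
        one_div_mul_eq_div]
      gcongr
      exact hu k
  refine ⟨max P (B + B' + c * P), fun k => (hP k).trans (le_max_left _ _),
    fun k => le_trans ?_ (le_max_right _ _)⟩
  have e : (k : ℝ) • (x (k + 1) - x k)
      = c • (x k - p) + (k : ℝ) • (x (k + 1) - x k) - c • (x k - p) := by abel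
  have h1 : (k : ℝ) * ‖x (k + 1) - x k‖ = ‖(k : ℝ) • (x (k + 1) - x k)‖ := by
    rw [norm_smul, Real.norm_of_nonneg (by positivity)]
  rw [h1, e]
  refine (norm_sub_le _ _).trans (add_le_add (hu k) ?_)
  rw [norm_smul, Real.norm_of_nonneg hc.le]
  exact mul_le_mul_of_nonneg_left (hP k) hc.le

variable [CompleteSpace H]

lemma igahdEnergy_succ_le (hconv : ConvexOn ℝ Set.univ f)
    (hdiff : ∀ z, HasGradientAt f (f' z) z)
    (hlip : ∀ z w, ‖f' z - f' w‖ ≤ L * ‖z - w‖) (hs : 0 < s) (hsL : L * s ≤ 1)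
    (hb : 0 ≤ b) (hbs : 2 * b ≤ s) (hI : IsInexactIGAHD f' α s b x y M N)
    {c : ℝ} (hc : 0 ≤ c) {k : ℕ} (hk : 1 ≤ k) (hck : 2 * c ≤ k) :
    igahdEnergy f f' s b x M p c (k + 1)
        + s * b * ((k : ℝ) + 1) ^ 2 / 2 * ‖f' (x (k + 1))‖ ^ 2
      ≤ s * (((k : ℝ) + 1) * ((k : ℝ) + 1 - c)) * (f (x (k + 1)) - f p)
        + ‖igahdVelocity f' b x M p c k - (α - 1 - c) • (x (k + 1) - x k)‖ ^ 2 / 2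
        + s * ((k : ℝ) + 1) * ‖N (k + 1)‖ * ‖igahdVelocity f' b x M p c (k + 1)‖
        + s * b * ((k : ℝ) + 1) ^ 2 * ‖M (k + 1)‖ ^ 2 := by
  have hstep := hI.step (k + 1) (by omega)
  have hw : igahdVelocity f' b x M p c k - (α - 1 - c) • (x (k + 1) - x k)
      = c • (x (k + 1) - p) + ((k : ℝ) + 1) • (y (k + 1) - x (k + 1))
        + (b * ((k : ℝ) + 1)) • (f' (x (k + 1)) + M (k + 1)) := by
    rw [hI.inertial k hk, igahdVelocity, igahdDamping]
    module
  have hv : igahdVelocity f' b x M p c (k + 1)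
      = igahdVelocity f' b x M p c k - (α - 1 - c) • (x (k + 1) - x k)
        - (s * ((k : ℝ) + 1)) • (f' (y (k + 1)) + N (k + 1)) := by
    rw [hw, igahdVelocity, igahdDamping, hstep]
    push_cast
    module
  have := inexact_step_energy_le hconv hdiff hlip hs hsL hb hbs (k := (k : ℝ) + 1)
    (by positivity) hc (by linarith) hw hv
  rw [igahdEnergy, hstep]
  push_cast
  linarith

/-- Consequences of the Lyapunov analysis with anchoring weight `α - 1`. -/
lemma IsInexactIGAHD.energy_estimates (hI : IsInexactIGAHD f' α s b x y M N)
    (hconv : ConvexOn ℝ Set.univ f) (hdiff : ∀ z, HasGradientAt f (f' z) z)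
    (hlip : ∀ z w, ‖f' z - f' w‖ ≤ L * ‖z - w‖) (hs : 0 < s) (hsL : L * s ≤ 1)
    (hb : 0 < b) (hbs : 2 * b ≤ s) (hα : 3 < α) (hp : ∀ z, f p ≤ f z)
    (hM : Summable fun k : ℕ => (k : ℝ) * ‖M k‖) (hN : Summable fun k : ℕ => (k : ℝ) * ‖N k‖) :
    (∃ l, Tendsto (igahdEnergy f f' s b x M p (α - 1)) atTop (nhds l)) ∧
    (∃ B, ∀ k, ‖igahdVelocity f' b x M p (α - 1) k‖ ≤ B) ∧
    (Summable fun k : ℕ => (k : ℝ) ^ 2 * ‖f' (x k)‖ ^ 2) ∧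
    Summable fun k : ℕ => (k : ℝ) * (f (x k) - f p) := by
  have hφ : ∀ k, 0 ≤ f (x k) - f p := fun k => sub_nonneg.2 (hp _)
  obtain ⟨K₀, hK₀⟩ := exists_nat_ge (2 * (α - 1))
  let E := igahdEnergy f f' s b x M p (α - 1)
  let r : ℕ → ℝ := fun k => ‖igahdVelocity f' b x M p (α - 1) k‖
  let a : ℕ → ℝ := fun k => s * ((k : ℝ) + 1) * ‖N (k + 1)‖
  let c : ℕ → ℝ := fun k => s * b * ((k : ℝ) + 1) ^ 2 * ‖M (k + 1)‖ ^ 2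
  let D : ℕ → ℝ := fun k => s * b * ((k : ℝ) + 1) ^ 2 / 2 * ‖f' (x (k + 1))‖ ^ 2
    + s * (α - 3) * (((k : ℝ) + 1) * (f (x (k + 1)) - f p))
  have hE0 : ∀ k, 0 ≤ E k := igahdEnergy_nonneg hs hp _
  have hr : ∀ k, r k ≤ 1 / 2 + E k := norm_igahdVelocity_le hs hp _
  have ha0 : ∀ k, 0 ≤ a k := fun k => by positivity
  have hc0 : ∀ k, 0 ≤ c k := fun k => by positivity
  have hD1 : ∀ k : ℕ, 0 ≤ s * (α - 3) * (((k : ℝ) + 1) * (f (x (k + 1)) - f p)) := fun k =>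
    mul_nonneg (mul_nonneg hs.le (by linarith)) (mul_nonneg (by positivity) (hφ _))
  have hD2 : ∀ k : ℕ, 0 ≤ s * b * ((k : ℝ) + 1) ^ 2 / 2 * ‖f' (x (k + 1))‖ ^ 2 :=
    fun k => by positivity
  have hD0 : ∀ k, 0 ≤ D k := fun k => add_nonneg (hD2 k) (hD1 k)
  have ha : Summable a := by
    refine (((summable_nat_add_iff 1).2 hN).mul_left s).congr fun k => ?_
    simp only [a]; push_cast; ring
  have hc : Summable c := by
    refine (((summable_nat_add_iff 1).2
      (hM.sq_of_nonneg fun k => by positivity)).mul_left (s * b)).congr fun k => ?_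
    simp only [c]; push_cast; ring
  have hstep : ∀ k ≥ max K₀ 1, E (k + 1) + D k ≤ E k + a k * r (k + 1) + c k := by
    intro k hk
    have hk' : (K₀ : ℝ) ≤ k := by exact_mod_cast (by omega : K₀ ≤ k)
    have h := igahdEnergy_succ_le (p := p) hconv hdiff hlip hs hsL hb.le hbs hI
      (c := α - 1) (by linarith) (by omega : 1 ≤ k) (by linarith)
    rw [sub_self, zero_smul, sub_zero] at h
    have h2 : s * (((k : ℝ) + 1) * ((k : ℝ) + 1 - (α - 1))) * (f (x (k + 1)) - f p)
        = s * (k : ℝ) ^ 2 * (f (x (k + 1)) - f p)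
          - s * (α - 3) * (((k : ℝ) + 1) * (f (x (k + 1)) - f p))
          - s * (f (x (k + 1)) - f p) := by ring
    have h3 : 0 ≤ s * (f (x (k + 1)) - f p) := mul_nonneg hs.le (hφ _)
    have h4 : E k = s * (k : ℝ) ^ 2 * (f (x (k + 1)) - f p) + r k ^ 2 / 2 := rfl
    simp only [E, D, a, c, r] at h4 ⊢
    linarith
  obtain ⟨B, hB⟩ := exists_forall_le_of_le_add_mul hE0 hr ha0 hc0 ha hc
    (K := max K₀ 1) fun k hk => by linarith [hstep k hk, hD0 k]
  have hrB : ∀ k, r k ≤ 1 / 2 + B := fun k => by linarith [hr k, hB k]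
  obtain ⟨hlim, hD⟩ := tendsto_and_summable_of_le_add hE0 hD0
    ((ha.mul_right (1 / 2 + B)).add hc) (K := max K₀ 1) fun k hk => by
      linarith [hstep k hk, mul_le_mul_of_nonneg_left (hrB (k + 1)) (ha0 k)]
  refine ⟨hlim, ⟨_, hrB⟩, (summable_nat_add_iff 1).1 ?_, (summable_nat_add_iff 1).1 ?_⟩
  · refine Summable.of_nonneg_of_le (fun k => by positivity) (fun k => ?_)
      (hD.mul_left (2 / (s * b)))
    have : ((k + 1 : ℕ) : ℝ) ^ 2 * ‖f' (x (k + 1))‖ ^ 2 = 2 / (s * b) *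
        (s * b * ((k : ℝ) + 1) ^ 2 / 2 * ‖f' (x (k + 1))‖ ^ 2) := by
      push_cast; field_simp
    rw [this]
    exact mul_le_mul_of_nonneg_left (le_add_of_nonneg_right (hD1 k)) (by positivity)
  · have hα3 : 0 < α - 3 := by linarith
    refine Summable.of_nonneg_of_le (fun k => mul_nonneg (by positivity) (hφ _)) (fun k => ?_)
      (hD.mul_left (1 / (s * (α - 3))))
    have : ((k + 1 : ℕ) : ℝ) * (f (x (k + 1)) - f p) = 1 / (s * (α - 3)) *
        (s * (α - 3) * (((k : ℝ) + 1) * (f (x (k + 1)) - f p))) := by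
      push_cast; field_simp
    rw [this]
    exact mul_le_mul_of_nonneg_left (le_add_of_nonneg_left (hD2 k)) (by positivity)

/-- The energy without anchoring converges. -/
lemma IsInexactIGAHD.tendsto_energy_zero (hI : IsInexactIGAHD f' α s b x y M N)
    (hconv : ConvexOn ℝ Set.univ f) (hdiff : ∀ z, HasGradientAt f (f' z) z)
    (hlip : ∀ z w, ‖f' z - f' w‖ ≤ L * ‖z - w‖) (hs : 0 < s) (hsL : L * s ≤ 1)
    (hb : 0 < b) (hbs : 2 * b ≤ s) (hα : 1 ≤ α) (hp : ∀ z, f p ≤ f z)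
    (hM : Summable fun k : ℕ => (k : ℝ) * ‖M k‖) (hN : Summable fun k : ℕ => (k : ℝ) * ‖N k‖)
    (hφ : Summable fun k : ℕ => (k : ℝ) * (f (x k) - f p))
    (hq : Summable fun k => ‖igahdDamping f' b x M k‖ ^ 2)
    {R B : ℝ} (hR : ∀ k : ℕ, (k : ℝ) * ‖x (k + 1) - x k‖ ≤ R)
    (hB : ∀ k, ‖igahdVelocity f' b x M p 0 k‖ ≤ B) :
    ∃ l, Tendsto (igahdEnergy f f' s b x M p 0) atTop (nhds l) := by
  have hφ0 : ∀ k, 0 ≤ f (x k) - f p := fun k => sub_nonneg.2 (hp _)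
  have hd : Summable fun k : ℕ => ‖x (k + 1) - x k‖ ^ 2 := by
    refine (summable_nat_add_iff 1).1 (Summable.of_nonneg_of_le (fun k => by positivity)
      (fun k => ?_) (((summable_nat_add_iff 1).2
        (Real.summable_one_div_nat_pow.2 one_lt_two)).mul_left (R ^ 2)))
    have h1 := pow_le_pow_left₀ (by positivity) (hR (k + 1)) 2
    rw [mul_one_div, le_div_iff₀ (by positivity)]
    linarith
  have ha : Summable fun k : ℕ => s * ((k : ℝ) + 1) * ‖N (k + 1)‖ := by
    refine (((summable_nat_add_iff 1).2 hN).mul_left s).congr fun k => ?_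
    push_cast; ring
  have hc : Summable fun k : ℕ => s * b * ((k : ℝ) + 1) ^ 2 * ‖M (k + 1)‖ ^ 2 := by
    refine (((summable_nat_add_iff 1).2
      (hM.sq_of_nonneg fun k => by positivity)).mul_left (s * b)).congr fun k => ?_
    push_cast; ring
  have hφ' := ((summable_nat_add_iff 1).2 hφ).mul_left (2 * s)
  refine (tendsto_and_summable_of_le_add (D := fun _ => 0) (igahdEnergy_nonneg hs hp 0)
    (fun _ => le_rfl) ((((hφ'.add (hq.div_const 2)).add (hd.mul_left ((α - 1) ^ 2))).add
      (ha.mul_right B)).add hc) (K := 1) fun k hk => ?_).1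
  have h := igahdEnergy_succ_le (p := p) hconv hdiff hlip hs hsL hb.le hbs hI
    (c := 0) le_rfl hk (by simp)
  have h1 := mul_le_mul_of_nonneg_left (hB (k + 1))
    (by positivity : 0 ≤ s * ((k : ℝ) + 1) * ‖N (k + 1)‖)
  have h2 : 0 ≤ s * b * ((k : ℝ) + 1) ^ 2 / 2 * ‖f' (x (k + 1))‖ ^ 2 := by positivity
  have h3 : 0 ≤ s * (f (x (k + 1)) - f p) := mul_nonneg hs.le (hφ0 _)
  have h4 : ‖igahdVelocity f' b x M p 0 k - (α - 1 - 0) • (x (k + 1) - x k)‖ ^ 2 / 2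
      ≤ ‖igahdVelocity f' b x M p 0 k‖ ^ 2 / 2 + ‖igahdDamping f' b x M k‖ ^ 2 / 2
        + (α - 1) ^ 2 * ‖x (k + 1) - x k‖ ^ 2 := by
    have e1 : ⟪igahdVelocity f' b x M p 0 k, x (k + 1) - x k⟫
        = k * ‖x (k + 1) - x k‖ ^ 2 + ⟪igahdDamping f' b x M k, x (k + 1) - x k⟫ := by
      rw [igahdVelocity, zero_smul, zero_add, inner_add_left, real_inner_smul_left,
        real_inner_self_eq_norm_sq]
    have e2 := (abs_le.1 (abs_real_inner_le_norm (igahdDamping f' b x M k)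
      (x (k + 1) - x k))).1
    have hα' : 0 ≤ α - 1 := by linarith
    have e3 := mul_le_mul_of_nonneg_left e2 hα'
    have e4 : 0 ≤ (α - 1) * (k * ‖x (k + 1) - x k‖ ^ 2) := by positivity
    rw [sub_zero, norm_sub_sq_real, real_inner_smul_right, norm_smul,
      Real.norm_of_nonneg hα', e1]
    nlinarith [sq_nonneg (‖igahdDamping f' b x M k‖ - (α - 1) * ‖x (k + 1) - x k‖)]
  have h5 : igahdEnergy f f' s b x M p 0 k = s * (k : ℝ) ^ 2 * (f (x (k + 1)) - f p)
    + ‖igahdVelocity f' b x M p 0 k‖ ^ 2 / 2 := rfl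
  push_cast
  linarith

/-- Along the inexact IGAHD iterates, the distance to any minimizer converges, and the values
converge to the minimum. -/
lemma IsInexactIGAHD.tendsto_norm_sub_and_value (hI : IsInexactIGAHD f' α s b x y M N)
    (hconv : ConvexOn ℝ Set.univ f) (hdiff : ∀ z, HasGradientAt f (f' z) z)
    (hlip : ∀ z w, ‖f' z - f' w‖ ≤ L * ‖z - w‖) (hs : 0 < s) (hsL : L * s ≤ 1)
    (hb : 0 < b) (hbs : 2 * b ≤ s) (hα : 3 < α) (hp : ∀ z, f p ≤ f z)
    (hM : Summable fun k : ℕ => (k : ℝ) * ‖M k‖) (hN : Summable fun k : ℕ => (k : ℝ) * ‖N k‖) :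
    (∃ l, Tendsto (fun k => ‖x k - p‖) atTop (nhds l)) ∧
      Tendsto (fun k => f (x k)) atTop (nhds (f p)) := by
  obtain ⟨⟨l₁, hl₁⟩, ⟨B, hB⟩, hg, hφ⟩ :=
    hI.energy_estimates hconv hdiff hlip hs hsL hb hbs hα hp hM hN
  have hq := summable_norm_igahdDamping_sq (b := b) hg hM
  have hq0 : Tendsto (fun k => ‖igahdDamping f' b x M k‖) atTop (nhds 0) := by
    have := hq.tendsto_atTop_zero.sqrt
    simpa [Real.sqrt_sq] using this
  obtain ⟨B', hB'⟩ := hq0.bddAbove_range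
  have hq' : ∀ k, ‖igahdDamping f' b x M k‖ ≤ B' := fun k => hB' ⟨k, rfl⟩
  have hα1 : 0 < α - 1 := by linarith
  obtain ⟨R, hR, hR'⟩ := exists_norm_le_of_norm_igahdVelocity_le hα1 hB hq'
  have hV0 : ∀ k, igahdVelocity f' b x M p 0 k
      = (k : ℝ) • (x (k + 1) - x k) + igahdDamping f' b x M k := fun k => by
    rw [igahdVelocity, zero_smul, zero_add]
  have hB0 : ∀ k, ‖igahdVelocity f' b x M p 0 k‖ ≤ R + B' := fun k => by
    rw [hV0]
    refine (norm_add_le _ _).trans (add_le_add ?_ (hq' k))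
    rw [norm_smul, Real.norm_of_nonneg (by positivity)]
    exact hR' k
  obtain ⟨l₀, hl₀⟩ := hI.tendsto_energy_zero hconv hdiff hlip hs hsL hb hbs (by linarith) hp
    hM hN hφ hq hR' hB0
  have hpq : Tendsto (fun k => ⟪x k - p, igahdDamping f' b x M k⟫) atTop (nhds 0) := by
    refine squeeze_zero_norm (a := fun k => R * ‖igahdDamping f' b x M k‖) (fun k => ?_)
      (by simpa using hq0.const_mul R)
    exact (abs_real_inner_le_norm _ _).trans (by gcongr; exact hR k)
  have hd : Tendsto (fun k : ℕ => (k : ℝ) * ‖x (k + 1) - x k‖ ^ 2) atTop (nhds 0) := by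
    refine squeeze_zero' (Eventually.of_forall fun k => by positivity)
      ((eventually_ge_atTop 1).mono fun k hk => ?_) (tendsto_const_div_atTop_nhds_zero_nat (R ^ 2))
    have hk0 : (0 : ℝ) < k := by exact_mod_cast hk
    have h1 := pow_le_pow_left₀ (by positivity) (hR' k) 2
    rw [le_div_iff₀ hk0]
    linarith
  have hT : Tendsto (fun k : ℕ => (α - 1) * (‖x k - p‖ ^ 2 / 2)
      + k * (‖x (k + 1) - p‖ ^ 2 / 2 - ‖x k - p‖ ^ 2 / 2)) atTop
      (nhds ((l₁ - l₀) / (α - 1) + 0 / 2 - 0)) := by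
    refine ((((hl₁.sub hl₀).div_const (α - 1)).add (hd.div_const 2)).sub hpq).congr fun k => ?_
    have e1 : igahdVelocity f' b x M p (α - 1) k
        = (α - 1) • (x k - p) + igahdVelocity f' b x M p 0 k := by
      rw [hV0, igahdVelocity, add_assoc]
    have e2 : ‖igahdVelocity f' b x M p (α - 1) k‖ ^ 2
        = (α - 1) ^ 2 * ‖x k - p‖ ^ 2 + 2 * ((α - 1) * (k * ⟪x k - p, x (k + 1) - x k⟫
          + ⟪x k - p, igahdDamping f' b x M k⟫)) + ‖igahdVelocity f' b x M p 0 k‖ ^ 2 := by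
      rw [e1, norm_add_sq_real, norm_smul, real_inner_smul_left, hV0, inner_add_right,
        real_inner_smul_right, mul_pow, Real.norm_eq_abs, sq_abs]
    have e3 : ‖x (k + 1) - p‖ ^ 2 = ‖x k - p‖ ^ 2 + 2 * ⟪x k - p, x (k + 1) - x k⟫
        + ‖x (k + 1) - x k‖ ^ 2 := by
      rw [← norm_add_sq_real, sub_add_sub_cancel']
    rw [igahdEnergy, igahdEnergy, e2, e3]
    field_simp
    ring
  have hh := tendsto_of_tendsto_mul_add_natCast_mul_sub hα1 hT
  refine ⟨⟨_, ((hh.mul_const 2).sqrt).congr fun k => ?_⟩, ?_⟩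
  · rw [div_mul_cancel₀ _ two_ne_zero, Real.sqrt_sq (norm_nonneg _)]
  · rw [← tendsto_sub_nhds_zero_iff]
    refine squeeze_zero' (Eventually.of_forall fun k => sub_nonneg.2 (hp _))
      ((eventually_ge_atTop 1).mono fun k hk => ?_) hφ.tendsto_atTop_zero
    have hk1 : (1 : ℝ) ≤ k := by exact_mod_cast hk
    exact le_mul_of_one_le_left (sub_nonneg.2 (hp _)) hk1

end InexactIGAHD

/-- Theorem 2.1(iv)(c): with constant step-size, the iterates converge weakly to a
minimizer of `f`. -/
theorem igahd_weak_convergence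
    {H : Type*} [NormedAddCommGroup H] [InnerProductSpace ℝ H] [CompleteSpace H]
    (f : H → ℝ) (f' : H → H) (L : ℝ) (hL : 0 < L)
    (hconv : ConvexOn ℝ Set.univ f)
    (hdiff : ∀ z, HasGradientAt f (f' z) z)
    (hlip : ∀ z w, ‖f' z - f' w‖ ≤ L * ‖z - w‖)
    (xstar : H) (hmin : ∀ z, f xstar ≤ f z)
    (α : ℝ) (hα : 3 < α)
    (s β : ℕ → ℝ) (hs0 : s 0 = 0) (hβ0 : β 0 = 0)
    -- constant step-size `s_k ≡ sc ∈ (0, 1/L]` and damping `β_k ≡ η √sc / 2`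
    (sc : ℝ) (hsc_pos : 0 < sc) (hsc_le : sc ≤ 1 / L)
    (hs_const : ∀ k, 1 ≤ k → s k = sc)
    (η : ℝ) (hη0 : 0 < η) (hη1 : η ≤ 1)
    (hβ : ∀ k, 1 ≤ k → β k = η * Real.sqrt sc / 2)
    (x y Mx My : ℕ → H)
    (hx_init : x 1 = x 0)
    (hy : ∀ k, 1 ≤ k → y k = x k + (1 - α / (k : ℝ)) • (x k - x (k - 1))
        - (β k * Real.sqrt (s k)) • (f' (x k) + Mx k)
        + (β (k - 1) * Real.sqrt (s (k - 1)) * (1 - 1 / (k : ℝ))) •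
            (f' (x (k - 1)) + Mx (k - 1)))
    (hx : ∀ k, 1 ≤ k → x (k + 1) = y k - s k • (f' (y k) + My k))
    (hJ0x : Summable fun k : ℕ => s k * (k : ℝ) * ‖Mx k‖)
    (hJ0y : Summable fun k : ℕ => s k * (k : ℝ) * ‖My k‖) :
    ∃ xbar : H, (∀ z, f xbar ≤ f z) ∧
      ∀ h : H, Tendsto (fun k : ℕ => ⟪x k, h⟫) atTop (nhds ⟪xbar, h⟫) := by
  set b : ℝ := η * sc / 2 with hb_def
  have hb : 0 < b := by positivity
  have hbs : 2 * b ≤ sc := by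
    rw [hb_def]; nlinarith
  have hsL : L * sc ≤ 1 := by
    rw [le_div_iff₀ hL] at hsc_le; linarith
  have hβs : ∀ k, 1 ≤ k → β k * Real.sqrt (s k) = b := fun k hk => by
    rw [hβ k hk, hs_const k hk, hb_def, div_mul_eq_mul_div, mul_assoc,
      Real.mul_self_sqrt hsc_pos.le]
  have hI : IsInexactIGAHD f' α sc b x y Mx My := by
    refine ⟨fun k hk => ?_, fun k hk => by rw [hx k hk, hs_const k hk]⟩
    have hk0 : (k : ℝ) + 1 ≠ 0 := by positivity
    have h := hy (k + 1) (by omega)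
    rw [Nat.add_sub_cancel, hβs _ (by omega), hβs _ hk] at h
    push_cast at h
    have e1 : ((k : ℝ) + 1) * (1 - α / ((k : ℝ) + 1)) = (k : ℝ) + 1 - α := by field_simp
    have e2 : ((k : ℝ) + 1) * (b * (1 - 1 / ((k : ℝ) + 1))) = b * k := by field_simp; ring
    rw [h, ← e1, ← e2]
    module
  have hsum : ∀ e : ℕ → H, Summable (fun k : ℕ => s k * (k : ℝ) * ‖e k‖) →
      Summable fun k : ℕ => (k : ℝ) * ‖e k‖ := fun e he => by
    refine (he.mul_left sc⁻¹).congr fun k => ?_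
    rcases Nat.eq_zero_or_pos k with rfl | hk
    · simp
    · rw [hs_const k hk]; field_simp
  have key := fun (p : H) (hp : ∀ z, f p ≤ f z) =>
    hI.tendsto_norm_sub_and_value hconv hdiff hlip hsc_pos hsL hb hbs hα hp
      (hsum Mx hJ0x) (hsum My hJ0y)
  refine exists_weak_limit_of_tendsto_norm_sub (S := {p | ∀ z, f p ≤ f z}) ⟨xstar, hmin⟩
    (fun p hp => (key p hp).1) fun U p hU hp z => ?_
  refine le_trans ?_ (hmin z)
  have h1 : Tendsto (fun k => f p + (⟪x k, f' p⟫ - ⟪p, f' p⟫)) U (nhds (f p + 0)) := by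
    simpa using ((hp (f' p)).sub_const ⟪p, f' p⟫).const_add (f p)
  rw [add_zero] at h1
  refine le_of_tendsto_of_tendsto' h1 ((key xstar hmin).2.mono_left hU) fun k => ?_
  have := hconv.add_inner_gradient_le (hdiff p) (x k)
  rwa [real_inner_comm, inner_sub_left] at this
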